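/- Let d ≥ 2 be an integer and let F : (0,∞) → ℝ be a smooth function with F′(α) = α^{−d/2} for all α > 0. Then for all α_0, α_1 > 0 with α_0 ≠ α_1: (α_1/α_0)^{1/2} · ( α_0·F^{[2]}(α_0,α_0,α_1) + (4/d)·α_0²·F^{[3]}(α_0,α_0,α_0,α_1) ) = (2(α_0·α_1)^{1/2}/d) · ( α_0·F^{[2]}(α_0,α_0,α_1) − α_1·F^{[2]}(α_0,α_1,α_1) )/(α_1 − α_0). -/

import Mathlib

/-- First divided difference `h^[1](a,b)` at distinct points. -/
noncomputable def dd1 (h : ℝ → ℝ) (a b : ℝ) : ℝ := (h a - h b) / (a - b)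

/-- Divided difference `h^[2](a,a,b)` (using `h^[1](a,a) = h'(a)`). -/
noncomputable def dd2aab (h : ℝ → ℝ) (a b : ℝ) : ℝ := (deriv h a - dd1 h a b) / (a - b)

/-- Divided difference `h^[2](a,b,b)`. -/
noncomputable def dd2abb (h : ℝ → ℝ) (a b : ℝ) : ℝ := (dd1 h a b - deriv h b) / (a - b)

/-- Divided difference `h^[2](a,b,c)` with `a ≠ c`. -/
noncomputable def dd2abc (h : ℝ → ℝ) (a b c : ℝ) : ℝ := (dd1 h a b - dd1 h b c) / (a - c)

/-- Divided difference `h^[3](a,a,a,b)` (using `h^[2](a,a,a) = h''(a)/2`). -/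
noncomputable def dd3aaab (h : ℝ → ℝ) (a b : ℝ) : ℝ :=
  (deriv (deriv h) a / 2 - dd2aab h a b) / (a - b)

/-- Divided difference `h^[3](a,a,b,b)`. -/
noncomputable def dd3aabb (h : ℝ → ℝ) (a b : ℝ) : ℝ := (dd2aab h a b - dd2abb h a b) / (a - b)

/-- Divided difference `h^[3](a,a,c,b)`. -/
noncomputable def dd3aacb (h : ℝ → ℝ) (a c b : ℝ) : ℝ :=
  (dd2aab h a c - dd2abc h a c b) / (a - b)

/-- Divided difference `h^[3](a,c,c,b)`. -/
noncomputable def dd3accb (h : ℝ → ℝ) (a c b : ℝ) : ℝ :=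
  (dd2abb h a c - dd2aab h c b) / (a - b)

/-- Divided difference `h^[4](a,a,c,c,b)`. -/
noncomputable def dd4aaccb (h : ℝ → ℝ) (a c b : ℝ) : ℝ :=
  (dd3aabb h a c - dd3accb h a c b) / (a - b)

/-- Divided difference `h^[4](a,a,a,c,b)`. -/
noncomputable def dd4aaacb (h : ℝ → ℝ) (a c b : ℝ) : ℝ :=
  (dd3aaab h a c - dd3aacb h a c b) / (a - b)

/-- An antiderivative `F` of `x ^ s` on `(0,∞)` satisfies
`(1 + s) (F a - F b) = a ^ (1 + s) - b ^ (1 + s)`, including the case `s = -1`. -/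
theorem one_add_mul_sub_of_hasDerivAt_rpow {F : ℝ → ℝ} {s : ℝ}
    (hF : ∀ x : ℝ, 0 < x → HasDerivAt F (x ^ s) x) {a b : ℝ} (ha : 0 < a) (hb : 0 < b) :
    (1 + s) * (F a - F b) = a * a ^ s - b * b ^ s := by
  have hderiv : ∀ x ∈ Set.Ioi (0 : ℝ),
      HasDerivAt (fun y => (1 + s) * F y - y * y ^ s) 0 x := by
    intro x hx
    have hx : 0 < x := hx
    have h := ((hF x hx).const_mul (1 + s)).sub
      ((hasDerivAt_id' x).mul (Real.hasDerivAt_rpow_const (p := s) (Or.inl hx.ne')))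
    refine h.congr_deriv ?_
    rw [Real.rpow_sub_one hx.ne']
    field_simp
    ring
  have hconst := isOpen_Ioi.is_const_of_deriv_eq_zero isPreconnected_Ioi
    (fun x hx => (hderiv x hx).differentiableAt.differentiableWithinAt)
    (fun x hx => (hderiv x hx).deriv) (Set.mem_Ioi.mpr ha) (Set.mem_Ioi.mpr hb)
  linarith

/-- The second derivative of an antiderivative of `x ^ s` on `(0,∞)`. -/
theorem deriv_deriv_of_hasDerivAt_rpow {F : ℝ → ℝ} {s : ℝ}
    (hF : ∀ x : ℝ, 0 < x → HasDerivAt F (x ^ s) x) {a : ℝ} (ha : 0 < a) :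
    deriv (deriv F) a = s * (a ^ s / a) := by
  have heq : deriv F =ᶠ[nhds a] fun x => x ^ s := by
    filter_upwards [Ioi_mem_nhds ha] with x hx using (hF x hx).deriv
  rw [heq.deriv_eq, (Real.hasDerivAt_rpow_const (Or.inl ha.ne')).deriv,
    Real.rpow_sub_one ha.ne']

/-- If `F` is a smooth function on `(0,∞)` with `F′(α) = α^{−d/2}` (`d ≥ 2`),
then for all distinct `α₀, α₁ > 0`,
`(α₁/α₀)^{1/2}·(α₀·F^[2](α₀,α₀,α₁) + (4/d)·α₀²·F^[3](α₀,α₀,α₀,α₁))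
  = (2(α₀α₁)^{1/2}/d)·(α₀·F^[2](α₀,α₀,α₁) − α₁·F^[2](α₀,α₁,α₁))/(α₁ − α₀)`. -/
theorem stmt_8 (d : ℕ) (hd : 2 ≤ d) (F : ℝ → ℝ)
    (hFsmooth : ContDiffOn ℝ (⊤ : ℕ∞) F (Set.Ioi 0))
    (hF : ∀ x : ℝ, 0 < x → HasDerivAt F (x ^ (-(d : ℝ) / 2)) x)
    (α₀ α₁ : ℝ) (h₀ : 0 < α₀) (h₁ : 0 < α₁) (hne : α₀ ≠ α₁) :
    Real.sqrt (α₁ / α₀) *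
        (α₀ * dd2aab F α₀ α₁ + 4 / (d : ℝ) * α₀ ^ 2 * dd3aaab F α₀ α₁)
      = 2 * Real.sqrt (α₀ * α₁) / (d : ℝ) *
          ((α₀ * dd2aab F α₀ α₁ - α₁ * dd2abb F α₀ α₁) / (α₁ - α₀)) := by
  have hd0 : (d : ℝ) ≠ 0 := by positivity
  have hsub : α₀ - α₁ ≠ 0 := sub_ne_zero.mpr hne
  have hsqrt : Real.sqrt (α₁ / α₀) = Real.sqrt (α₀ * α₁) / α₀ := by
    rw [show α₁ / α₀ = α₀ * α₁ / α₀ ^ 2 by field_simp, Real.sqrt_div' _ (sq_nonneg _),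
      Real.sqrt_sq h₀.le]
  have hrel := one_add_mul_sub_of_hasDerivAt_rpow hF h₀ h₁
  rw [hsqrt]
  unfold dd3aaab dd2aab dd2abb dd1
  rw [deriv_deriv_of_hasDerivAt_rpow hF h₀, (hF α₀ h₀).deriv, (hF α₁ h₁).deriv,
    ← neg_sub α₀ α₁]
  generalize α₀ ^ (-(d : ℝ) / 2) = p at *
  generalize α₁ ^ (-(d : ℝ) / 2) = q at *
  generalize F α₀ = u at *
  generalize F α₁ = v at *
  generalize Real.sqrt (α₀ * α₁) = r at *
  have hq : q = (α₀ * p - (1 + -(d : ℝ) / 2) * (u - v)) / α₁ := by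
    field_simp
    linarith
  subst hq
  field_simp
  ring
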